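/- Let (N_j), (n_j), (k_j) be sequences of integers with 1 ≤ k_j ≤ n_j < N_j for all j, such that N_j → ∞, n_j/N_j → λ and k_j/n_j → φ for fixed constants 0 < λ < 1 and 0 < φ < 1. Then the standardized FPOS random variable converges in distribution to the standard normal: for every real z, Σ_{x : k_j ≤ x ≤ N_j−n_j+k_j and x ≤ μ_j + z·σ_j} f(x; k_j, n_j, N_j) → (1/√(2π))·∫_{−∞}^{z} exp(−u²/2) du as j → ∞, where μ_j and σ_j are the mean and standard deviation of the FPOS distribution with parameters (k_j, n_j, N_j). -/

import Mathlib

open Filter Topology MeasureTheory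
open scoped Classical

/-- The FPOS probability mass function: f(x; k, n, N) = C(x−1, k−1)·C(N−x, n−k) / C(N, n). -/
noncomputable def fpos (k n N x : ℕ) : ℝ :=
  (((x - 1).choose (k - 1) * (N - x).choose (n - k) : ℕ) : ℝ) / (N.choose n : ℝ)

/-- The mean of the FPOS distribution: μ(k, n, N) = k(N+1)/(n+1). -/
noncomputable def fposMean (k n N : ℕ) : ℝ := (k : ℝ) * ((N : ℝ) + 1) / ((n : ℝ) + 1)

/-- The variance of the FPOS distribution:
σ²(k, n, N) = (N+1)(N−n)k(n−k+1)/((n+1)²(n+2)). -/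
noncomputable def fposVar (k n N : ℕ) : ℝ :=
  ((N : ℝ) + 1) * ((N : ℝ) - (n : ℝ)) * (k : ℝ) * ((n : ℝ) - (k : ℝ) + 1) /
    (((n : ℝ) + 1) ^ 2 * ((n : ℝ) + 2))

/-- The standard deviation of the FPOS distribution. -/
noncomputable def fposSD (k n N : ℕ) : ℝ := Real.sqrt (fposVar k n N)


lemma vand (a b m : ℕ) : ∑ i ∈ Finset.range (m+1), (i + a).choose a * (m - i + b).choose b
    = (m + a + b + 1).choose (a+b+1) := by
  have h1 := PowerSeries.mk_one_pow_eq_mk_choose_add (S := ℤ) a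
  have h2 := PowerSeries.mk_one_pow_eq_mk_choose_add (S := ℤ) b
  have h3 := PowerSeries.mk_one_pow_eq_mk_choose_add (S := ℤ) (a+b+1)
  have h4 : (PowerSeries.mk 1 : PowerSeries ℤ)^(a+b+1+1) = PowerSeries.mk 1 ^(a+1) * PowerSeries.mk 1 ^ (b+1) := by
    ring
  rw [h1, h2, h3] at h4
  have h5 := congrArg (PowerSeries.coeff m) h4
  rw [PowerSeries.coeff_mul, Finset.Nat.sum_antidiagonal_eq_sum_range_succ_mk] at h5
  simp only [PowerSeries.coeff_mk] at h5
  norm_cast at h5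
  rw [show m + a + b + 1 = a + b + 1 + m by ring, h5]
  refine Finset.sum_congr rfl fun i _ => ?_
  rw [add_comm i a, add_comm (m-i) b]

lemma h_bound (t : ℝ) (ht : |t| ≤ 1/2) :
    |((1+t) * Real.log (1+t) - t) - t^2/2| ≤ 4 * |t|^3 := by
  have h := Real.abs_log_sub_add_sum_range_le (x := -t) (by rw [abs_neg]; linarith) 2
  simp only [Finset.sum_range_succ, Finset.sum_range_zero, abs_neg, sub_neg_eq_add] at h
  have h0 := abs_nonneg t
  have h3 : |t|^(2+1) / (1 - |t|) ≤ 2 * |t|^3 := by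
    rw [div_le_iff₀ (by linarith)]
    have : 0 ≤ |t|^3 := by positivity
    norm_num
    nlinarith
  set r := Real.log (1+t) - t + t^2/2 with hr
  have hr' : |r| ≤ 2 * |t|^3 := by
    refine le_trans (le_of_eq ?_) (h.trans h3)
    congr 1
    rw [hr]; push_cast; ring
  have e : ((1+t) * Real.log (1+t) - t) - t^2/2 = -(t^3/2) + (1+t) * r := by rw [hr]; ring
  rw [e]
  have h1 : |1+t| ≤ 3/2 := by
    rw [abs_le] at ht ⊢; constructor <;> linarith
  calc _ ≤ |-(t^3/2)| + |(1+t)*r| := abs_add_le _ _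
    _ = |t|^3/2 + |1+t| * |r| := by rw [abs_neg, abs_mul, abs_div, abs_pow]; norm_num
    _ ≤ |t|^3/2 + 3/2 * (2*|t|^3) := by gcongr
    _ ≤ _ := by have : 0 ≤ |t|^3 := by positivity
                linarith

/-- c_j t_j^2 → b, t_j → 0 -/
lemma h_lim (c t : ℕ → ℝ) (b : ℝ) (hc : Tendsto (fun j => c j * t j^2) atTop (𝓝 b))
    (ht : Tendsto t atTop (𝓝 0)) :
    Tendsto (fun j => c j * ((1+t j) * Real.log (1+t j) - t j)) atTop (𝓝 (b/2)) := by
  have h1 : Tendsto (fun j => c j * (((1+t j) * Real.log (1+t j) - t j) - t j^2/2)) atTop (𝓝 0) := by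
    have h2 : Tendsto (fun j => 4 * (|c j * t j^2| * |t j|)) atTop (𝓝 0) := by
      simpa using ((hc.abs.mul ht.abs).const_mul 4)
    refine squeeze_zero_norm' ?_ h2
    have : ∀ᶠ j in atTop, |t j| < 1/2 := by
      have := ht.abs
      rw [abs_zero] at this
      exact this.eventually_lt_const (by norm_num)
    filter_upwards [this] with j hj
    rw [Real.norm_eq_abs, abs_mul]
    calc _ ≤ |c j| * (4 * |t j|^3) := by gcongr; exact h_bound _ hj.le
      _ = _ := by rw [abs_mul, abs_pow]; ring
  have h3 := h1.add (hc.div_const 2)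
  rw [zero_add] at h3
  refine h3.congr fun j => ?_
  ring

lemma fact_stirling (n : ℕ) (hn : n ≠ 0) : (n.factorial : ℝ) =
    Stirling.stirlingSeq n * (√(2*n) * (n / Real.exp 1)^n) := by
  unfold Stirling.stirlingSeq
  have : (0:ℝ) < n := by positivity
  field_simp

lemma binom_id (M m : ℕ) (p : ℝ) (hp0 : 0 < p) (hp1 : p < 1) (hm0 : 0 < m) (hm : m < M) :
    √(M:ℝ) * ((M.choose m : ℝ) * p^m * (1-p)^(M-m)) =
    Stirling.stirlingSeq M / (Stirling.stirlingSeq m * Stirling.stirlingSeq (M-m)) *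
     (1 / √(2 * (m/M) * (1 - m/M))) *
     Real.exp (-(M * p * ((1 + (m - M*p)/(M*p)) * Real.log (1 + (m - M*p)/(M*p)) - (m - M*p)/(M*p))
      + M * (1-p) * ((1 + -(m - M*p)/(M*(1-p))) * Real.log (1 + -(m - M*p)/(M*(1-p))) - -(m - M*p)/(M*(1-p))))) := by
  obtain ⟨l, rfl⟩ := Nat.exists_eq_add_of_lt hm
  have hq : 0 < 1 - p := by linarith
  have e1 : m + l + 1 - m = l + 1 := by omega
  rw [e1, Nat.choose_eq_factorial_div_factorial hm.le, Nat.cast_div (Nat.factorial_mul_factorial_dvd_factorial hm.le) (by positivity)]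
  rw [e1]
  push_cast
  rw [fact_stirling m hm0.ne', fact_stirling (l+1) (by omega), fact_stirling (m+l+1) (by omega)]
  have hs1 : 0 < Stirling.stirlingSeq m := by
    obtain ⟨r, rfl⟩ := Nat.exists_eq_succ_of_ne_zero hm0.ne'
    exact Stirling.stirlingSeq'_pos r
  have hs2 := Stirling.stirlingSeq'_pos l
  set K := l + 1 with hK
  have hK0 : 0 < K := by omega
  have hc : ((m + l + 1 : ℕ):ℝ) = m + K := by rw [hK]; push_cast; ring
  have hc2 : ((m:ℝ) + l + 1) = m + K := by rw [hK]; push_cast; ring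
  rw [hc2, hc]
  have hmR : (0:ℝ) < m := by positivity
  have hKR : (0:ℝ) < K := by positivity
  generalize Stirling.stirlingSeq (m+l+1) = S0
  generalize Stirling.stirlingSeq m = S1 at *
  generalize Stirling.stirlingSeq K = S2 at *
  have e2 : (1 + ((m:ℝ) - (m+K)*p)/((m+K)*p)) = m / ((m+K)*p) := by field_simp; ring
  have e3 : (1 + -((m:ℝ) - (m+K)*p)/((m+K)*(1-p))) = K / ((m+K)*(1-p)) := by field_simp; ring
  rw [e2, e3]
  have e4 : (-(((m:ℝ)+K) * p * (m / ((m+K)*p) * Real.log (m / ((m+K)*p)) - (m - (m+K)*p)/((m+K)*p))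
      + (m+K) * (1-p) * (K / ((m+K)*(1-p)) * Real.log (K / ((m+K)*(1-p))) - -(m - (m+K)*p)/((m+K)*(1-p)))))
      = m * Real.log ((m+K)*p/m) + K * Real.log ((m+K)*(1-p)/K) := by
    rw [← inv_div ((m+K)*p) (m:ℝ), ← inv_div ((m+K)*(1-p)) (K:ℝ), Real.log_inv, Real.log_inv]
    field_simp
    ring
  rw [e4, Real.exp_add, mul_comm (m:ℝ) (Real.log _), mul_comm (K:ℝ) (Real.log _), Real.exp_mul, Real.exp_mul,
    Real.exp_log (by positivity), Real.exp_log (by positivity), Real.rpow_natCast, Real.rpow_natCast]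
  have e5 : m + l + 1 = m + K := by omega
  rw [e5, pow_add]
  have e6 : √(2 * ((m:ℝ) / (m+K)) * (1 - m/(m+K))) = √(2*m) * √(2*K) / (√2 * (m+K)) := by
    rw [show 2 * ((m:ℝ) / (m+K)) * (1 - m/(m+K)) = (2*m) * (2*K)/(2*(m+K)^2) by field_simp; ring]
    rw [Real.sqrt_div (by positivity), Real.sqrt_mul (by positivity), Real.sqrt_mul (by positivity : (0:ℝ) ≤ 2) (((m:ℝ)+K)^2), Real.sqrt_sq (by positivity)]
  have e7 : √(2 * ((m:ℝ) + K)) = √2 * √(m+K) := Real.sqrt_mul (by positivity) _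
  have e8 : √((m:ℝ)+K) * √(m+K) = m + K := Real.mul_self_sqrt (by positivity)
  rw [e6, e7]
  have p1 : 0 < √(2*(m:ℝ)) := by positivity
  have p2 : 0 < √(2*(K:ℝ)) := by positivity
  have p3 : 0 < √((2:ℝ)) := by positivity
  simp only [div_pow, mul_pow]
  generalize √(2*(m:ℝ)) = A at *
  generalize √(2*(K:ℝ)) = B at *
  generalize √((2:ℝ)) = C at *
  generalize √((m:ℝ)+K) = D at *
  have pe := Real.exp_pos 1
  field_simp
  rw [sq, e8]
  ring

lemma binom_local (M m : ℕ → ℕ) (p : ℕ → ℝ) (P a : ℝ) (hP0 : 0 < P) (hP1 : P < 1)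
    (hM : Tendsto (fun j => (M j : ℝ)) atTop atTop) (hp : Tendsto p atTop (𝓝 P))
    (ha : Tendsto (fun j => ((m j : ℝ) - M j * p j) / √(M j : ℝ)) atTop (𝓝 a)) :
    Tendsto (fun j => √(M j:ℝ) * (((M j).choose (m j) : ℝ) * p j^(m j) * (1-p j)^(M j-m j))) atTop
      (𝓝 (1/√(2 * Real.pi * (P * (1-P))) * Real.exp (-(a^2 / (2 * (P * (1-P))))))) := by
  have hM0 : ∀ᶠ j in atTop, (0:ℝ) < M j := hM.eventually_gt_atTop 0
  have hQ0 : 0 < 1 - P := by linarith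
  have hq : Tendsto (fun j => 1 - p j) atTop (𝓝 (1-P)) := tendsto_const_nhds.sub hp
  have hp0 : ∀ᶠ j in atTop, 0 < p j := hp.eventually_const_lt hP0
  have hp1 : ∀ᶠ j in atTop, p j < 1 := hp.eventually_lt_const hP1
  have hsq : Tendsto (fun j => √(M j : ℝ)) atTop atTop := Real.tendsto_sqrt_atTop.comp hM
  have hd0 : Tendsto (fun j => ((m j : ℝ) - M j * p j) / (M j : ℝ)) atTop (𝓝 0) := by
    have := ha.div_atTop hsq
    refine this.congr' ?_
    filter_upwards [hM0] with j hj
    rw [div_div, Real.mul_self_sqrt hj.le]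
  have hmM : Tendsto (fun j => (m j : ℝ) / M j) atTop (𝓝 P) := by
    have := hd0.add hp
    rw [zero_add] at this
    refine this.congr' ?_
    filter_upwards [hM0] with j hj
    field_simp; ring
  have hm0 : ∀ᶠ j in atTop, 0 < m j := by
    filter_upwards [hmM.eventually_const_lt hP0] with j hj
    rcases Nat.eq_zero_or_pos (m j) with h | h
    · simp [h] at hj
    · exact h
  have hm1 : ∀ᶠ j in atTop, m j < M j := by
    filter_upwards [hmM.eventually_lt_const hP1, hM0] with j hj hj0
    rw [div_lt_one hj0] at hj
    exact_mod_cast hj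
  have hmt : Tendsto m atTop atTop := by
    have : Tendsto (fun j => (m j : ℝ)) atTop atTop := by
      refine (hmM.pos_mul_atTop hP0 hM).congr' ?_
      filter_upwards [hM0] with j hj
      field_simp
    exact tendsto_natCast_atTop_iff.1 this
  have hMt : Tendsto M atTop atTop := tendsto_natCast_atTop_iff.1 hM
  have hlt : Tendsto (fun j => M j - m j) atTop atTop := by
    have : Tendsto (fun j => ((M j - m j : ℕ) : ℝ)) atTop atTop := by
      refine (Tendsto.pos_mul_atTop hQ0 (tendsto_const_nhds.sub hmM : Tendsto (fun j => 1 - (m j : ℝ) / M j) _ _) hM).congr' ?_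
      filter_upwards [hM0, hm1] with j hj hj1
      rw [Nat.cast_sub hj1.le]
      field_simp
    exact tendsto_natCast_atTop_iff.1 this
  have st := Stirling.tendsto_stirlingSeq_sqrt_pi
  have hpi : 0 < √Real.pi := by positivity
  have T1 := (st.comp hMt).div ((st.comp hmt).mul (st.comp hlt)) (by positivity)
  have T2 : Tendsto (fun j => 1 / √(2 * ((m j : ℝ) / M j) * (1 - (m j : ℝ) / M j))) atTop (𝓝 (1 / √(2 * P * (1-P)))) := by
    refine Tendsto.div tendsto_const_nhds ?_ (by positivity)
    exact ((hmM.const_mul 2).mul (tendsto_const_nhds.sub hmM)).sqrt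
  have T3 := h_lim (fun j => M j * p j) (fun j => ((m j : ℝ) - M j * p j)/(M j * p j)) (a^2/P) (by
    refine ((ha.pow 2).div hp hP0.ne').congr' ?_
    filter_upwards [hM0, hp0] with j h1 h2
    simp only [Pi.div_apply]
    rw [div_pow, Real.sq_sqrt h1.le]
    field_simp) (by
    have := hd0.div hp hP0.ne'
    rw [zero_div] at this
    refine this.congr fun j => ?_
    simp only [Pi.div_apply]
    rw [div_div])
  have T4 := h_lim (fun j => M j * (1-p j)) (fun j => -((m j : ℝ) - M j * p j)/(M j * (1-p j))) (a^2/(1-P)) (by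
    refine ((ha.pow 2).div hq hQ0.ne').congr' ?_
    filter_upwards [hM0, hp1] with j h1 h2
    have : 0 < 1 - p j := by linarith
    simp only [Pi.div_apply]
    rw [div_pow, Real.sq_sqrt h1.le]
    field_simp) (by
    have := (hd0.div hq hQ0.ne').neg
    rw [zero_div, neg_zero] at this
    refine this.congr fun j => ?_
    simp only [Pi.div_apply]
    rw [div_div, neg_div])
  have T5 := (T1.mul T2).mul ((Real.continuous_exp.tendsto _).comp (T3.add T4).neg)
  have eL : √Real.pi / (√Real.pi * √Real.pi) * (1 / √(2 * P * (1-P))) * Real.exp (-(a^2/P/2 + a^2/(1-P)/2))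
      = 1/√(2 * Real.pi * (P * (1-P))) * Real.exp (-(a^2 / (2 * (P * (1-P))))) := by
    congr 1
    · rw [show 2 * Real.pi * (P * (1-P)) = Real.pi * (2 * P * (1-P)) by ring, Real.sqrt_mul Real.pi_pos.le]
      field_simp
    · congr 2
      field_simp
      ring
  rw [eL] at T5
  refine T5.congr' ?_
  filter_upwards [hm0, hm1, hp0, hp1] with j h1 h2 h3 h4
  rw [binom_id _ _ _ h3 h4 h1 h2]
  rfl
lemma fpos_id (k n N x : ℕ) (p : ℝ) (hp0 : 0 < p) (hp1 : p < 1) (hk : 1 ≤ k) (hkn : k ≤ n) (hn : n < N)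
    (hkx : k ≤ x) (hx : x ≤ N - n + k) :
    fpos k n N x = (k / x : ℝ) * ((x.choose k : ℝ) * p^k * (1-p)^(x-k)) *
      (((N-x).choose (n-k) : ℝ) * p^(n-k) * (1-p)^(N-x-(n-k))) /
      ((N.choose n : ℝ) * p^n * (1-p)^(N-n)) := by
  unfold fpos
  have hq : 0 < 1 - p := by linarith
  have e1 : p^n = p^k * p^(n-k) := by rw [← pow_add]; congr 1; omega
  have e2 : (1-p)^(N-n) = (1-p)^(x-k) * (1-p)^(N-x-(n-k)) := by rw [← pow_add]; congr 1; omega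
  have e3 : (x:ℝ) * ((x-1).choose (k-1) : ℝ) = (x.choose k : ℝ) * k := by
    obtain ⟨y, rfl⟩ : ∃ y, x = y + 1 := ⟨x-1, by omega⟩
    obtain ⟨l, rfl⟩ : ∃ l, k = l + 1 := ⟨k-1, by omega⟩
    have := Nat.add_one_mul_choose_eq y l
    simp only [Nat.add_sub_cancel]
    exact_mod_cast this
  have hx0 : (0:ℝ) < x := by have : 0 < x := by omega
                             exact_mod_cast this
  have hc : (0:ℝ) < N.choose n := by exact_mod_cast Nat.choose_pos hn.le
  rw [e1, e2]
  push_cast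
  have : 0 < (1-p)^(x-k) := by positivity
  have : 0 < (1-p)^(N-x-(n-k)) := by positivity
  field_simp
  linear_combination ((N - x).choose (n - k) : ℝ) * e3

lemma total (k n N : ℕ) (hk : 1 ≤ k) (hkn : k ≤ n) (hn : n < N) :
    ∑ x ∈ Finset.Icc k (N - n + k), fpos k n N x = 1 := by
  have hc : (0:ℝ) < N.choose n := by exact_mod_cast Nat.choose_pos hn.le
  unfold fpos
  rw [← Finset.sum_div, div_eq_one_iff_eq hc.ne', ← Nat.cast_sum]
  congr 1
  have h := vand (k-1) (n-k) (N-n)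
  have e1 : N - n + (k-1) + (n-k) + 1 = N := by omega
  have e2 : k - 1 + (n-k) + 1 = n := by omega
  rw [e1, e2] at h
  rw [← h]
  have e3 : Finset.Icc k (N-n+k) = Finset.Ico k (N-n+1+k) := by
    ext x; simp only [Finset.mem_Icc, Finset.mem_Ico]; omega
  rw [e3, Finset.sum_Ico_eq_sum_range]
  have e4 : N - n + 1 + k - k = N - n + 1 := by omega
  rw [e4]
  refine Finset.sum_congr rfl fun i hi => ?_
  rw [Finset.mem_range] at hi
  congr 2 <;> omega

section
variable (N n k : ℕ → ℕ)
    (hbounds : ∀ j, 1 ≤ k j ∧ k j ≤ n j ∧ n j < N j)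
    (lam phi : ℝ) (hlam0 : 0 < lam) (hlam1 : lam < 1) (hphi0 : 0 < phi) (hphi1 : phi < 1)
    (hN : Tendsto (fun j => (N j : ℝ)) atTop atTop)
    (hn : Tendsto (fun j => (n j : ℝ) / (N j : ℝ)) atTop (𝓝 lam))
    (hk : Tendsto (fun j => (k j : ℝ) / (n j : ℝ)) atTop (𝓝 phi))
include hbounds hlam0 hN hn hk

lemma n_lim : Tendsto (fun j => (n j : ℝ)) atTop atTop := by
  refine (hn.pos_mul_atTop hlam0 hN).congr' ?_
  filter_upwards [hN.eventually_gt_atTop 0] with j hj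
  field_simp

lemma mean_lim : Tendsto (fun j => fposMean (k j) (n j) (N j) / N j) atTop (𝓝 phi) := by
  have h1 := n_lim N n k hbounds lam phi hlam0 hN hn hk
  have a1 : Tendsto (fun j => 1 + 1 / (N j:ℝ)) atTop (𝓝 (1+0)) :=
    tendsto_const_nhds.add (hN.const_div_atTop 1)
  have a2 : Tendsto (fun j => 1 + 1 / (n j:ℝ)) atTop (𝓝 (1+0)) :=
    tendsto_const_nhds.add (h1.const_div_atTop 1)
  have := (hk.mul a1).div a2 (by norm_num)
  norm_num at this
  refine this.congr' ?_
  filter_upwards [hN.eventually_gt_atTop 0, h1.eventually_gt_atTop 0] with j hj hj1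
  simp only [Pi.div_apply, fposMean]
  field_simp

lemma var_lim : Tendsto (fun j => fposVar (k j) (n j) (N j) / N j) atTop
    (𝓝 ((1-lam) * phi * (1-phi) / lam)) := by
  have h1 := n_lim N n k hbounds lam phi hlam0 hN hn hk
  have a1 : Tendsto (fun j => 1 + 1 / (N j:ℝ)) atTop (𝓝 (1+0)) :=
    tendsto_const_nhds.add (hN.const_div_atTop 1)
  have a2 : Tendsto (fun j => 1 + 1 / (n j:ℝ)) atTop (𝓝 (1+0)) :=
    tendsto_const_nhds.add (h1.const_div_atTop 1)
  have a3 : Tendsto (fun j => 1 + 2 / (n j:ℝ)) atTop (𝓝 (1+0)) :=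
    tendsto_const_nhds.add (h1.const_div_atTop 2)
  have a4 : Tendsto (fun j => 1 - (k j:ℝ) / n j + 1 / (n j:ℝ)) atTop (𝓝 (1-phi+0)) :=
    (tendsto_const_nhds.sub hk).add (h1.const_div_atTop 1)
  have a5 : Tendsto (fun j => 1 - (n j:ℝ) / N j) atTop (𝓝 (1-lam)) :=
    (tendsto_const_nhds.sub hn)
  have := (((a1.mul a5).mul hk).mul a4).div (((a2.pow 2).mul a3).mul hn) (by simpa using hlam0.ne')
  norm_num at this
  refine this.congr' ?_
  filter_upwards [hN.eventually_gt_atTop 0, h1.eventually_gt_atTop 0] with j hj hj1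
  simp only [Pi.div_apply, fposVar]
  field_simp

include hlam1 hphi0 hphi1
lemma fpos_local (x : ℕ → ℕ) (v : ℝ)
    (hx : Tendsto (fun j => ((x j : ℝ) - fposMean (k j) (n j) (N j)) / √(N j : ℝ)) atTop (𝓝 v)) :
    (∀ᶠ j in atTop, k j ≤ x j ∧ x j ≤ N j - n j + k j) ∧
    Tendsto (fun j => √(N j : ℝ) * fpos (k j) (n j) (N j) (x j)) atTop
      (𝓝 (1 / √(2 * Real.pi * ((1-lam) * phi * (1-phi) / lam)) *
        Real.exp (-(v^2/(2 * ((1-lam) * phi * (1-phi) / lam)))))) := by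
  have hnl := n_lim N n k hbounds lam phi hlam0 hN hn hk
  have hml := mean_lim N n k hbounds lam phi hlam0 hN hn hk
  have hsN : Tendsto (fun j => √(N j : ℝ)) atTop atTop := Real.tendsto_sqrt_atTop.comp hN
  have hN0 := hN.eventually_gt_atTop 0
  have hn0 := hnl.eventually_gt_atTop 0
  have hl : 0 < 1 - lam := by linarith
  have hf : 0 < 1 - phi := by linarith
  have hxN : Tendsto (fun j => (x j : ℝ) / N j) atTop (𝓝 phi) := by
    have := (hx.div_atTop hsN).add hml
    rw [zero_add] at this
    refine this.congr' ?_
    filter_upwards [hN0] with j hj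
    rw [div_div, Real.mul_self_sqrt hj.le]
    field_simp; ring
  have hkN : Tendsto (fun j => (k j : ℝ) / N j) atTop (𝓝 (phi * lam)) := by
    refine (hk.mul hn).congr' ?_
    filter_upwards [hN0, hn0] with j hj hj1
    field_simp
  have ev1 : ∀ᶠ j in atTop, k j ≤ x j := by
    have : phi * lam < phi := by nlinarith
    filter_upwards [hkN.eventually_lt hxN this, hN0] with j hj hj0
    rw [div_lt_div_iff_of_pos_right hj0] at hj
    exact_mod_cast hj.le
  have ev2 : ∀ᶠ j in atTop, x j ≤ N j - n j + k j := by
    have h1 : Tendsto (fun j => 1 - (n j : ℝ) / N j + k j / N j) atTop (𝓝 (1 - lam + phi * lam)) :=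
      (tendsto_const_nhds.sub hn).add hkN
    have : phi < 1 - lam + phi * lam := by nlinarith
    filter_upwards [hxN.eventually_lt h1 this, hN0] with j hj hj0
    have e : 1 - (n j : ℝ) / N j + k j / N j = ((N j - n j + k j : ℕ) : ℝ) / N j := by
      push_cast [Nat.cast_sub (hbounds j).2.2.le]
      field_simp
    rw [e, div_lt_div_iff_of_pos_right hj0] at hj
    exact_mod_cast hj.le
  refine ⟨ev1.and ev2, ?_⟩
  have hxlt : ∀ᶠ j in atTop, x j < N j := by
    filter_upwards [hxN.eventually_lt_const hphi1, hN0] with j hj hj0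
    rw [div_lt_one hj0] at hj
    exact_mod_cast hj
  have hx0 : ∀ᶠ j in atTop, 0 < x j := by
    filter_upwards [ev1] with j hj
    have := (hbounds j).1
    omega
  have hxN' : Tendsto (fun j => ((N j - x j : ℕ) : ℝ) / N j) atTop (𝓝 (1 - phi)) := by
    refine (tendsto_const_nhds.sub hxN : Tendsto (fun j => 1 - (x j : ℝ) / N j) _ _).congr' ?_
    filter_upwards [hN0, hxlt] with j hj hj1
    rw [Nat.cast_sub hj1.le]; field_simp
  have hxt : Tendsto (fun j => (x j : ℝ)) atTop atTop := by
    refine (hxN.pos_mul_atTop hphi0 hN).congr' ?_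
    filter_upwards [hN0] with j hj
    field_simp
  have hxt' : Tendsto (fun j => ((N j - x j : ℕ) : ℝ)) atTop atTop := by
    refine (hxN'.pos_mul_atTop hf hN).congr' ?_
    filter_upwards [hN0] with j hj
    field_simp
  -- centering
  have hcen : Tendsto (fun j => ((k j : ℝ) - x j * (n j / N j)) / √(N j : ℝ)) atTop (𝓝 (-(v * lam))) := by
    have h1 : Tendsto (fun j => (k j : ℝ) * (N j - n j) / ((n j + 1) * N j) / √(N j : ℝ)) atTop (𝓝 0) := by
      refine squeeze_zero' ?_ ?_ (hsN.const_div_atTop 1)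
      · filter_upwards with j
        have : (n j : ℝ) ≤ N j := by exact_mod_cast (hbounds j).2.2.le
        have : 0 ≤ (N j : ℝ) - n j := by linarith
        positivity
      · filter_upwards [hN0] with j hj
        have h1 : (n j : ℝ) ≤ N j := by exact_mod_cast (hbounds j).2.2.le
        have h2 : (k j : ℝ) ≤ n j := by exact_mod_cast (hbounds j).2.1
        gcongr
        rw [div_le_one (by positivity)]
        apply mul_le_mul <;> first | positivity | linarith
    have h2 := h1.sub (hx.mul hn)
    rw [zero_sub] at h2
    refine h2.congr' ?_
    filter_upwards [hN0] with j hj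
    have : 0 < √(N j : ℝ) := by positivity
    unfold fposMean
    field_simp
    ring
  have sx : Tendsto (fun j => √((x j : ℝ)/ N j)) atTop (𝓝 (√phi)) := hxN.sqrt
  have sx' : Tendsto (fun j => √(((N j - x j : ℕ) : ℝ)/ N j)) atTop (𝓝 (√(1-phi))) := hxN'.sqrt
  have hp1 : 0 < √phi := by positivity
  have hp2 : 0 < √(1-phi) := by positivity
  have B1 := binom_local x k (fun j => (n j : ℝ)/N j) lam (-(v*lam)/√phi) hlam0 hlam1 hxt hn (by
    refine (hcen.div sx hp1.ne').congr' ?_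
    filter_upwards [hN0] with j hj
    have : 0 < √(N j : ℝ) := by positivity
    simp only [Pi.div_apply]
    rw [Real.sqrt_div (by positivity), div_div, mul_div_cancel₀ _ this.ne'])
  have B2 := binom_local (fun j => N j - x j) (fun j => n j - k j) (fun j => (n j : ℝ)/N j) lam (-(-(v*lam))/√(1-phi)) hlam0 hlam1 hxt' hn (by
    refine (hcen.neg.div sx' hp2.ne').congr' ?_
    filter_upwards [hN0, hxlt] with j hj hj1
    have : 0 < √(N j : ℝ) := by positivity
    simp only [Pi.div_apply]
    rw [Real.sqrt_div (by positivity), ← neg_div, div_div, mul_div_cancel₀ _ this.ne']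
    congr 1
    rw [Nat.cast_sub hj1.le, Nat.cast_sub (hbounds j).2.1]
    field_simp
    ring)
  have B3 := binom_local N n (fun j => (n j : ℝ)/N j) lam 0 hlam0 hlam1 hN hn (by
    refine tendsto_const_nhds.congr' ?_
    filter_upwards [hN0] with j hj
    field_simp
    simp)
  have K1 := hkN.div hxN hphi0.ne'
  have F := ((K1.mul B1).mul B2).div (B3.mul (sx.mul sx')) (by positivity)
  have hpi := Real.pi_pos
  have eL : (phi * lam / phi * (1 / √(2 * Real.pi * (lam * (1-lam))) * Real.exp (-((-(v*lam)/√phi)^2/(2 * (lam * (1-lam)))))) *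
      (1 / √(2 * Real.pi * (lam * (1-lam))) * Real.exp (-((-(-(v*lam))/√(1-phi))^2/(2 * (lam * (1-lam))))))) /
      (1 / √(2 * Real.pi * (lam * (1-lam))) * Real.exp (-(0^2/(2 * (lam * (1-lam))))) * (√phi * √(1-phi)))
      = (1 / √(2 * Real.pi * ((1-lam) * phi * (1-phi) / lam)) *
        Real.exp (-(v^2/(2 * ((1-lam) * phi * (1-phi) / lam))))) := by
    have e1 : Real.exp (-(v^2/(2 * ((1-lam) * phi * (1-phi) / lam)))) =
      Real.exp (-((-(v*lam)/√phi)^2/(2 * (lam * (1-lam))))) * Real.exp (-((-(-(v*lam))/√(1-phi))^2/(2 * (lam * (1-lam))))) := by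
      rw [← Real.exp_add]
      congr 1
      rw [div_pow, div_pow, Real.sq_sqrt hphi0.le, Real.sq_sqrt hf.le]
      field_simp
      ring
    have e2 : √(2 * Real.pi * ((1-lam) * phi * (1-phi) / lam)) = √(2 * Real.pi * (lam * (1-lam))) * (√phi * √(1-phi)) / lam := by
      rw [← Real.sqrt_mul hphi0.le, ← Real.sqrt_mul (by positivity)]
      rw [show 2 * Real.pi * ((1-lam) * phi * (1-phi) / lam) = (2 * Real.pi * (lam * (1-lam)) * (phi * (1-phi))) / lam^2 by field_simp]
      rw [Real.sqrt_div (by positivity), Real.sqrt_sq hlam0.le]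
    rw [e1, e2]
    have : 0 < √(2 * Real.pi * (lam * (1-lam))) := by positivity
    have e3 : Real.exp (-(0^2/(2 * (lam * (1-lam))))) = 1 := by simp
    rw [e3]
    field_simp
  rw [eL] at F
  refine F.congr' ?_
  filter_upwards [ev1, ev2, hN0, hn0, hx0, hxlt] with j h1 h2 h3 h4 h5 h6
  obtain ⟨b1, b2, b3⟩ := hbounds j
  have hlt : (n j : ℝ) / N j < 1 := by
    rw [div_lt_one h3]; exact_mod_cast b3
  have hgt : (0:ℝ) < (n j : ℝ) / N j := by positivity
  rw [fpos_id (k j) (n j) (N j) (x j) _ hgt hlt b1 b2 b3 h1 h2]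
  simp only [Pi.div_apply]
  have hc : (0:ℝ) < (N j).choose (n j) := by exact_mod_cast Nat.choose_pos b3.le
  have hd : 0 < ((N j).choose (n j) : ℝ) * (n j / N j : ℝ)^(n j) * (1 - (n j / N j : ℝ))^(N j - n j) := by
    have : 0 < 1 - (n j / N j : ℝ) := by linarith
    positivity
  generalize ((N j).choose (n j) : ℝ) * (n j / N j : ℝ)^(n j) * (1 - (n j / N j : ℝ))^(N j - n j) = D3 at *
  generalize ((x j).choose (k j) : ℝ) * (n j / N j : ℝ)^(k j) * (1 - (n j / N j : ℝ))^(x j - k j) = D1 at *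
  generalize ((N j - x j).choose (n j - k j) : ℝ) * (n j / N j : ℝ)^(n j - k j) * (1 - (n j / N j : ℝ))^(N j - x j - (n j - k j)) = D2 at *
  have h7 : (0:ℝ) < ((N j - x j : ℕ):ℝ) := by
    have : 0 < N j - x j := by omega
    exact_mod_cast this
  have h8 : (0:ℝ) < x j := by exact_mod_cast h5
  rw [Real.sqrt_div (by positivity), Real.sqrt_div (by positivity)]
  have q1 : 0 < √(N j : ℝ) := by positivity
  have q2 : 0 < √(x j : ℝ) := by positivity
  have q3 : 0 < √((N j - x j : ℕ) : ℝ) := by positivity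
  field_simp

end

lemma half (S : ℕ → Finset ℕ) (A : Set ℝ) (hA : MeasurableSet A) (f : ℕ → ℕ → ℝ) (mu sg : ℕ → ℝ)
    (hsg : ∀ j, 0 < sg j) (hf : ∀ j x, 0 ≤ f j x) (g : ℝ → ℝ)
    (h : ∀ u ∈ A, ∃ x : ℕ → ℕ, (∀ᶠ j in atTop, x j ∈ S j ∧ u ∈ Set.Ico ((x j - mu j) / sg j) ((x j + 1 - mu j) / sg j)) ∧
      Tendsto (fun j => sg j * f j (x j)) atTop (𝓝 (g u))) :
    ∫⁻ u in A, ENNReal.ofReal (g u) ≤ liminf (fun j => ENNReal.ofReal (∑ x ∈ S j, f j x)) atTop := by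
  let G : ℕ → ℝ → ENNReal := fun j u => ∑ x ∈ S j,
    (Set.Ico (((x:ℝ) - mu j) / sg j) (((x:ℝ) + 1 - mu j) / sg j)).indicator (fun _ => ENNReal.ofReal (sg j * f j x)) u
  have hG : ∀ j, Measurable (G j) := fun j =>
    Finset.measurable_fun_sum _ fun x _ => measurable_const.indicator measurableSet_Ico
  have hint : ∀ j, ∫⁻ u, G j u = ENNReal.ofReal (∑ x ∈ S j, f j x) := by
    intro j
    rw [lintegral_finset_sum _ fun x _ => measurable_const.indicator measurableSet_Ico,
      ENNReal.ofReal_sum_of_nonneg fun x _ => hf j x]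
    refine Finset.sum_congr rfl fun x _ => ?_
    rw [lintegral_indicator_const measurableSet_Ico, Real.volume_Ico, ← ENNReal.ofReal_mul (mul_nonneg (hsg j).le (hf j x))]
    congr 1
    have := hsg j
    field_simp
    ring
  calc ∫⁻ u in A, ENNReal.ofReal (g u) ≤ ∫⁻ u in A, liminf (fun j => G j u) atTop := by
        refine setLIntegral_mono' hA fun u hu => ?_
        obtain ⟨x, hx, ht⟩ := h u hu
        have ht' : Tendsto (fun j => ENNReal.ofReal (sg j * f j (x j))) atTop (𝓝 (ENNReal.ofReal (g u))) :=
          (ENNReal.continuous_ofReal.tendsto _).comp ht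
        rw [← ht'.liminf_eq]
        refine liminf_le_liminf ?_
        filter_upwards [hx] with j hj
        refine le_trans (le_of_eq ?_) (Finset.single_le_sum (fun _ _ => zero_le) hj.1)
        rw [Set.indicator_of_mem hj.2]
    _ ≤ ∫⁻ u, liminf (fun j => G j u) atTop := setLIntegral_le_lintegral _ _
    _ ≤ liminf (fun j => ∫⁻ u, G j u) atTop := lintegral_liminf_le hG
    _ = _ := by simp only [hint]

lemma two_sided (s t : ℕ → ℝ) (a b : ℝ) (hab : a + b = 1)
    (hst : ∀ j, s j + t j = 1)
    (h1 : ENNReal.ofReal a ≤ liminf (fun j => ENNReal.ofReal (s j)) atTop)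
    (h2 : ENNReal.ofReal b ≤ liminf (fun j => ENNReal.ofReal (t j)) atTop)
    (hs : ∀ j, 0 ≤ s j) (ht : ∀ j, 0 ≤ t j) :
    Tendsto s atTop (𝓝 a) := by
  have key : ∀ (s : ℕ → ℝ) (a : ℝ), (∀ j, 0 ≤ s j) →
      ENNReal.ofReal a ≤ liminf (fun j => ENNReal.ofReal (s j)) atTop → ∀ c < a, ∀ᶠ j in atTop, c < s j := by
    intro s a hs h c hc
    rcases lt_or_ge c 0 with h0 | h0
    · exact Eventually.of_forall fun j => h0.trans_le (hs j)
    · have : ENNReal.ofReal c < liminf (fun j => ENNReal.ofReal (s j)) atTop :=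
        lt_of_lt_of_le ((ENNReal.ofReal_lt_ofReal_iff (h0.trans_lt hc)).2 hc) h
      filter_upwards [eventually_lt_of_lt_liminf this] with j hj
      exact (ENNReal.ofReal_lt_ofReal_iff'.1 hj).1
  refine tendsto_order.2 ⟨key s a hs h1, fun c hc => ?_⟩
  filter_upwards [key t b ht h2 (1 - c) (by linarith)] with j hj
  have := hst j
  linarith

theorem fpos_clt (N n k : ℕ → ℕ)
    (hbounds : ∀ j, 1 ≤ k j ∧ k j ≤ n j ∧ n j < N j)
    (lam phi : ℝ) (hlam0 : 0 < lam) (hlam1 : lam < 1) (hphi0 : 0 < phi) (hphi1 : phi < 1)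
    (hN : Tendsto (fun j => (N j : ℝ)) atTop atTop)
    (hn : Tendsto (fun j => (n j : ℝ) / (N j : ℝ)) atTop (𝓝 lam))
    (hk : Tendsto (fun j => (k j : ℝ) / (n j : ℝ)) atTop (𝓝 phi)) :
    ∀ z : ℝ,
      Tendsto (fun j =>
          ∑ x ∈ (Finset.Icc (k j) (N j - n j + k j)).filter
              (fun x : ℕ => (x : ℝ) ≤ fposMean (k j) (n j) (N j) + z * fposSD (k j) (n j) (N j)),
            fpos (k j) (n j) (N j) x)
        atTop
        (𝓝 ((1 / Real.sqrt (2 * Real.pi)) * ∫ u in Set.Iic z, Real.exp (-u ^ 2 / 2))) := by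
  intro z
  set mu : ℕ → ℝ := fun j => fposMean (k j) (n j) (N j) with hmu
  set sg : ℕ → ℝ := fun j => fposSD (k j) (n j) (N j) with hsgdef
  have hsg : ∀ j, 0 < sg j := by
    intro j
    obtain ⟨b1, b2, b3⟩ := hbounds j
    have c1 : (0:ℝ) < k j := by exact_mod_cast b1
    have c2 : (k j : ℝ) ≤ n j := by exact_mod_cast b2
    have c3 : (n j : ℝ) < N j := by exact_mod_cast b3
    have c4 : 0 < (N j : ℝ) - n j := by linarith
    have c5 : 0 < (n j : ℝ) - k j + 1 := by linarith
    refine Real.sqrt_pos.2 ?_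
    unfold fposVar
    positivity
  have hf0 : ∀ j x, 0 ≤ fpos (k j) (n j) (N j) x := fun j x => by unfold fpos; positivity
  have hl : 0 < 1 - lam := by linarith
  have hf : 0 < 1 - phi := by linarith
  have hpi := Real.pi_pos
  set V := (1-lam) * phi * (1-phi) / lam with hV
  have hV0 : 0 < V := by positivity
  have hsl : Tendsto (fun j => sg j / √(N j : ℝ)) atTop (𝓝 (√V)) := by
    refine (var_lim N n k hbounds lam phi hlam0 hN hn hk).sqrt.congr fun j => ?_
    rw [Real.sqrt_div' _ (by positivity)]
    rfl
  have hsN : Tendsto (fun j => √(N j : ℝ)) atTop atTop := Real.tendsto_sqrt_atTop.comp hN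
  have hN0 := hN.eventually_gt_atTop 0
  have hsinf : Tendsto sg atTop atTop := by
    refine (hsl.pos_mul_atTop (by positivity : 0 < √V) hsN).congr' ?_
    filter_upwards [hN0] with j hj
    have : 0 < √(N j : ℝ) := by positivity
    field_simp
  set g : ℝ → ℝ := fun u => 1 / √(2 * Real.pi) * Real.exp (-u^2/2) with hg
  have hloc : ∀ u : ℝ, ∃ x : ℕ → ℕ, (∀ᶠ j in atTop, (k j ≤ x j ∧ x j ≤ N j - n j + k j) ∧
      (x j : ℝ) ≤ mu j + u * sg j ∧ mu j + u * sg j < x j + 1) ∧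
      Tendsto (fun j => sg j * fpos (k j) (n j) (N j) (x j)) atTop (𝓝 (g u)) := by
    intro u
    have hpos : ∀ᶠ j in atTop, 0 ≤ mu j + u * sg j := by
      have h1 := (mean_lim N n k hbounds lam phi hlam0 hN hn hk).add ((hsl.div_atTop hsN).const_mul u)
      rw [mul_zero, add_zero] at h1
      filter_upwards [h1.eventually_const_lt hphi0, hN0] with j hj hj0
      rw [div_div, Real.mul_self_sqrt hj0.le, ← mul_div_assoc, ← add_div] at hj
      exact ((div_pos_iff_of_pos_right hj0).1 hj).le
    have hx : Tendsto (fun j => ((⌊mu j + u * sg j⌋₊ : ℝ) - mu j) / √(N j : ℝ)) atTop (𝓝 (u * √V)) := by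
      have h1 : Tendsto (fun j => ((⌊mu j + u * sg j⌋₊ : ℝ) - (mu j + u * sg j)) / √(N j : ℝ)) atTop (𝓝 0) := by
        refine squeeze_zero_norm' ?_ (hsN.const_div_atTop 1)
        filter_upwards [hpos] with j hj
        rw [Real.norm_eq_abs, abs_div, abs_of_nonneg (Real.sqrt_nonneg _)]
        gcongr
        have q1 := Nat.floor_le hj
        have q2 := Nat.lt_floor_add_one (mu j + u * sg j)
        rw [abs_le]
        constructor <;> linarith
      have h2 := h1.add (hsl.const_mul u)
      rw [zero_add] at h2
      refine h2.congr fun j => ?_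
      ring
    obtain ⟨e1, e2⟩ := fpos_local N n k hbounds lam phi hlam0 hlam1 hphi0 hphi1 hN hn hk _ _ hx
    refine ⟨fun j => ⌊mu j + u * sg j⌋₊, ?_, ?_⟩
    · filter_upwards [e1, hpos] with j h1 h2
      exact ⟨h1, Nat.floor_le h2, Nat.lt_floor_add_one _⟩
    · have h3 := hsl.mul e2
      have : √V * (1 / √(2 * Real.pi * V) * Real.exp (-((u * √V)^2/(2 * V)))) = g u := by
        rw [hg, Real.sqrt_mul (by positivity), mul_pow, Real.sq_sqrt hV0.le]
        have : 0 < √V := by positivity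
        have e : -(u^2 * V / (2 * V)) = -u^2/2 := by field_simp
        rw [e]
        field_simp
      rw [this] at h3
      refine h3.congr' ?_
      filter_upwards [hN0] with j hj
      have : 0 < √(N j : ℝ) := by positivity
      field_simp
  have gint : Integrable (fun u : ℝ => Real.exp (-u^2/2)) := by
    have := integrable_exp_neg_mul_sq (b := 1/2) (by norm_num)
    refine this.congr (Eventually.of_forall fun u => ?_)
    simp only
    congr 1; ring
  have gtot : ∫ u : ℝ, Real.exp (-u^2/2) = √(2 * Real.pi) := by
    have := integral_gaussian (1/2)
    rw [show Real.pi / (1/2) = 2 * Real.pi by ring] at this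
    rw [← this]
    congr 1; ext u; congr 1; ring
  have hofR : ∀ A : Set ℝ, ENNReal.ofReal (1 / √(2 * Real.pi) * ∫ u in A, Real.exp (-u^2/2)) = ∫⁻ u in A, ENNReal.ofReal (g u) := by
    intro A
    rw [← integral_const_mul, ofReal_integral_eq_lintegral_ofReal]
    · exact (gint.const_mul _).integrableOn
    · exact Eventually.of_forall fun u => by positivity
  refine two_sided _ (fun j => ∑ x ∈ (Finset.Icc (k j) (N j - n j + k j)).filter
              (fun x : ℕ => ¬ (x : ℝ) ≤ mu j + z * sg j), fpos (k j) (n j) (N j) x)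
      _ ((1 / Real.sqrt (2 * Real.pi)) * ∫ u in Set.Ioi z, Real.exp (-u ^ 2 / 2)) ?_ ?_ ?_ ?_ ?_ ?_
  · rw [← mul_add, ← Set.compl_Iic, integral_add_compl measurableSet_Iic gint, gtot]
    field_simp
  · intro j
    rw [Finset.sum_filter_add_sum_filter_not]
    exact total _ _ _ (hbounds j).1 (hbounds j).2.1 (hbounds j).2.2
  · rw [hofR]
    refine half _ _ measurableSet_Iic _ mu sg hsg hf0 g fun u hu => ?_
    obtain ⟨x, h1, h2⟩ := hloc u
    refine ⟨x, ?_, h2⟩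
    filter_upwards [h1] with j hj
    have hs := hsg j
    refine ⟨?_, ?_, ?_⟩
    · rw [Finset.mem_filter, Finset.mem_Icc]
      refine ⟨hj.1, hj.2.1.trans ?_⟩
      have : u ≤ z := hu
      gcongr
    · rw [div_le_iff₀ hs]; linarith [hj.2.1]
    · rw [lt_div_iff₀ hs]; linarith [hj.2.2]
  · rw [hofR]
    refine half _ _ measurableSet_Ioi _ mu sg hsg hf0 g fun u hu => ?_
    obtain ⟨x, h1, h2⟩ := hloc u
    have hu' : z < u := hu
    refine ⟨x, ?_, h2⟩
    filter_upwards [h1, hsinf.eventually_gt_atTop (1/(u - z))] with j hj hj2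
    have hs := hsg j
    refine ⟨?_, ?_, ?_⟩
    · rw [Finset.mem_filter, Finset.mem_Icc]
      refine ⟨hj.1, ?_⟩
      rw [div_lt_iff₀ (by linarith)] at hj2
      rw [not_le]
      have := hj.2.2
      nlinarith
    · rw [div_le_iff₀ hs]; linarith [hj.2.1]
    · rw [lt_div_iff₀ hs]; linarith [hj.2.2]
  · exact fun j => Finset.sum_nonneg fun x _ => hf0 j x
  · exact fun j => Finset.sum_nonneg fun x _ => hf0 j x
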